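/- Let a pairwise graphical model be binary, i.e. Y_u = {0,1} for every node u, and let L be its local polytope. Then every vertex of L is half-integral: if μ' ∈ L and there exists a cost vector c such that μ' is the unique minimizer of μ ↦ ⟨c,μ⟩ over L, then every coordinate of μ' lies in {0, 1/2, 1}. -/

import Mathlib

open Finset

variable {V : Type} [Fintype V] [DecidableEq V]

/-- Membership in the local polytope `L`: `μ ≥ 0`, each unary block lies in the
probability simplex, both coupling (marginalization) constraints hold, the
pairwise blocks are symmetric (one variable per unordered edge) and vanish on
non-edges. -/
def memLocal (G : SimpleGraph V) [DecidableRel G.Adj]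
    (Y : V → Type) [∀ u, Fintype (Y u)]
    (μv : ∀ u, Y u → ℝ) (μe : ∀ u v, Y u → Y v → ℝ) : Prop :=
  (∀ u s, 0 ≤ μv u s) ∧
  (∀ u v, G.Adj u v → ∀ s t, 0 ≤ μe u v s t) ∧
  (∀ u v s t, μe u v s t = μe v u t s) ∧
  (∀ u v, ¬ G.Adj u v → ∀ s t, μe u v s t = 0) ∧
  (∀ u, ∑ s, μv u s = 1) ∧
  (∀ u v, G.Adj u v → ∀ t : Y v, ∑ s, μe u v s t = μv v t) ∧
  (∀ u v, G.Adj u v → ∀ s : Y u, ∑ t, μe u v s t = μv u s)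

/-- The standard inner product `⟨c,μ⟩` over all coordinates of `μ`. -/
noncomputable def ipRaw
    (cv : V → Bool → ℝ) (ce : V → V → Bool → Bool → ℝ)
    (μv : V → Bool → ℝ) (μe : V → V → Bool → Bool → ℝ) : ℝ :=
  (∑ u, ∑ s, cv u s * μv u s) + ∑ u, ∑ v, ∑ s, ∑ t, ce u v s t * μe u v s t

open Filter Topology in
theorem eventually_nonneg_add_mul {a d : ℝ} (ha : 0 ≤ a) (hd : a = 0 → d = 0) :
    ∀ᶠ ε in 𝓝 (0 : ℝ), 0 ≤ a + ε * d := by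
  rcases ha.eq_or_lt with h | h
  · simp [hd h.symm, ha]
  · have hc : Tendsto (fun ε : ℝ => a + ε * d) (𝓝 0) (𝓝 (a + 0 * d)) :=
      (by fun_prop : Continuous fun ε : ℝ => a + ε * d).tendsto 0
    have hpos : 0 < a + 0 * d := by simpa using h
    exact (hc.eventually (lt_mem_nhds hpos)).mono fun _ h => h.le

omit [DecidableEq V] in
theorem ipRaw_add_mul (cv : V → Bool → ℝ) (ce : V → V → Bool → Bool → ℝ)
    (μv dv : V → Bool → ℝ) (μe de : V → V → Bool → Bool → ℝ) (ε : ℝ) :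
    ipRaw cv ce (fun u s => μv u s + ε * dv u s) (fun u v s t => μe u v s t + ε * de u v s t) =
      ipRaw cv ce μv μe + ε * ipRaw cv ce dv de := by
  simp only [ipRaw, mul_add, sum_add_distrib, mul_left_comm _ ε, ← mul_sum]
  ring

omit [DecidableEq V] in
/-- A feasible direction at a unique minimizer over the local polytope whose negative is
also feasible must vanish. -/
theorem direction_eq_zero (G : SimpleGraph V) [DecidableRel G.Adj]
    {μv : V → Bool → ℝ} {μe : V → V → Bool → Bool → ℝ}
    (hμ : memLocal G (fun _ => Bool) μv μe)
    (hvert : ∃ (cv : V → Bool → ℝ) (ce : V → V → Bool → Bool → ℝ),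
        ∀ νv νe, memLocal G (fun _ => Bool) νv νe → (νv, νe) ≠ (μv, μe) →
          ipRaw cv ce μv μe < ipRaw cv ce νv νe)
    {dv : V → Bool → ℝ} {de : V → V → Bool → Bool → ℝ}
    (hdv : ∀ u s, μv u s = 0 → dv u s = 0)
    (hde : ∀ u v, G.Adj u v → ∀ s t, μe u v s t = 0 → de u v s t = 0)
    (hsymm : ∀ u v s t, de u v s t = de v u t s)
    (hnadj : ∀ u v, ¬ G.Adj u v → ∀ s t, de u v s t = 0)
    (hsum : ∀ u, ∑ s, dv u s = 0)
    (hright : ∀ u v, G.Adj u v → ∀ t, ∑ s, de u v s t = dv v t)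
    (hleft : ∀ u v, G.Adj u v → ∀ s, ∑ t, de u v s t = dv u s) :
    dv = 0 ∧ de = 0 := by
  obtain ⟨h1, h2, h3, h4, h5, h6, h7⟩ := hμ
  obtain ⟨cv, ce, hmin⟩ := hvert
  have hnonneg : ∀ᶠ ε in nhds (0 : ℝ), (∀ u s, 0 ≤ μv u s + ε * dv u s) ∧
      ∀ u v, G.Adj u v → ∀ s t, 0 ≤ μe u v s t + ε * de u v s t := by
    simp only [Filter.eventually_and, Filter.eventually_all]
    exact ⟨fun u s => eventually_nonneg_add_mul (h1 u s) (hdv u s),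
      fun u v h s t => eventually_nonneg_add_mul (h2 u v h s t) (hde u v h s t)⟩
  obtain ⟨δ, hδ, hball⟩ := Metric.eventually_nhds_iff.1 hnonneg
  have hmem : ∀ ε : ℝ, |ε| < δ → memLocal G (fun _ => Bool)
      (fun u s => μv u s + ε * dv u s) (fun u v s t => μe u v s t + ε * de u v s t) := by
    intro ε hε
    obtain ⟨hv, he⟩ := @hball ε (by simpa using hε)
    refine ⟨hv, he, fun u v s t => by dsimp only; rw [h3, hsymm],
      fun u v h s t => by simp [h4 u v h, hnadj u v h], fun u => ?_,
      fun u v h t => ?_, fun u v h s => ?_⟩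
    · rw [sum_add_distrib, ← mul_sum, h5, hsum]; simp
    · rw [sum_add_distrib, ← mul_sum, h6 u v h, hright u v h]
    · rw [sum_add_distrib, ← mul_sum, h7 u v h, hleft u v h]
  by_contra hne
  have hlt : ∀ ε : ℝ, |ε| < δ → ε ≠ 0 → 0 < ε * ipRaw cv ce dv de := by
    intro ε hε hε0
    have h := hmin _ _ (hmem ε hε) fun heq => hne ?_
    · rw [ipRaw_add_mul] at h
      linarith
    · obtain ⟨hv, he⟩ := Prod.mk.inj heq
      constructor
      · funext u s
        simpa [hε0] using congrFun (congrFun hv u) s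
      · funext u v s t
        simpa [hε0] using congrFun (congrFun (congrFun (congrFun he u) v) s) t
  have hpos := hlt (δ / 2) (by rw [abs_of_pos] <;> linarith) (by linarith)
  have hneg := hlt (-(δ / 2)) (by rw [abs_neg, abs_of_pos] <;> linarith) (by linarith)
  linarith

/-- The direction in which a unary marginal moves: up below `1 / 2`, down above
`1 / 2`, and not at all at the half-integral values. -/
noncomputable def unaryShift (x : ℝ) : ℝ :=
  if x = 0 ∨ x = 1 / 2 ∨ x = 1 then 0 else if x < 1 / 2 then 1 else -1

theorem unaryShift_eq_zero_iff {x : ℝ} :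
    unaryShift x = 0 ↔ x = 0 ∨ x = 1 / 2 ∨ x = 1 := by
  unfold unaryShift
  split_ifs <;> simp_all

theorem unaryShift_one_sub (x : ℝ) : unaryShift (1 - x) = -unaryShift x := by
  unfold unaryShift
  grind

/-- The direction in which the pairwise marginal `p` of the label pair `(true, true)` moves, given
the unary marginals `x` and `y` of the label `true`. -/
noncomputable def pairShift (x y p : ℝ) : ℝ :=
  if p = 0 then 0
  else if p = x then unaryShift x
  else if p = y then unaryShift y
  else if p = x + y - 1 then unaryShift x + unaryShift y
  else 1

theorem pairShift_comm (x y p : ℝ) : pairShift x y p = pairShift y x p := by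
  unfold pairShift
  grind

theorem pairShift_zero (x y : ℝ) : pairShift x y 0 = 0 := by
  simp [pairShift]

theorem pairShift_left (x y : ℝ) : pairShift x y x = unaryShift x := by
  unfold pairShift
  have := @unaryShift_eq_zero_iff x
  grind

theorem pairShift_add_sub_one (x y : ℝ) :
    pairShift x y (x + y - 1) = unaryShift x + unaryShift y := by
  have h1 : unaryShift 1 = 0 := unaryShift_eq_zero_iff.2 (by simp)
  have hy := unaryShift_one_sub x
  unfold pairShift
  grind

theorem half_integral_of_pairShift_eq_zero {x y p : ℝ} (hp : 0 ≤ p) (hpx : p ≤ x) (hpy : p ≤ y)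
    (hxy : x + y - 1 ≤ p) (hx : unaryShift x = 0) (hy : unaryShift y = 0)
    (h : pairShift x y p = 0) :
    p = 0 ∨ p = 1 / 2 ∨ p = 1 := by
  rw [unaryShift_eq_zero_iff] at hx hy
  unfold pairShift at h
  grind

/-- The direction of movement of the unary block with marginal `x` of the label `true`. -/
noncomputable def unaryDirection (x : ℝ) (s : Bool) : ℝ :=
  if s then unaryShift x else -unaryShift x

/-- The direction of movement of the pairwise block with unary marginals `x` and `y` and
pairwise marginal `p` of the label pair `(true, true)`. -/
noncomputable def pairDirection (x y p : ℝ) : Bool → Bool → ℝ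
  | true, true => pairShift x y p
  | true, false => unaryShift x - pairShift x y p
  | false, true => unaryShift y - pairShift x y p
  | false, false => pairShift x y p - unaryShift x - unaryShift y

/-- **Half-integrality of the vertices of the binary local polytope**: if a
point `μ'` of the local polytope of a binary model (labels `Bool`) is the
unique minimizer of some linear functional `⟨c,·⟩` over the local polytope,
then every coordinate of `μ'` lies in `{0, 1/2, 1}`. -/
theorem statement_17 (G : SimpleGraph V) [DecidableRel G.Adj]
    (μv : V → Bool → ℝ) (μe : V → V → Bool → Bool → ℝ)
    (hμ : memLocal G (fun _ => Bool) μv μe)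
    (hvert : ∃ (cv : V → Bool → ℝ) (ce : V → V → Bool → Bool → ℝ),
        ∀ νv νe, memLocal G (fun _ => Bool) νv νe → (νv, νe) ≠ (μv, μe) →
          ipRaw cv ce μv μe < ipRaw cv ce νv νe) :
    (∀ u s, μv u s = 0 ∨ μv u s = 1 / 2 ∨ μv u s = 1) ∧
    (∀ u v s t, μe u v s t = 0 ∨ μe u v s t = 1 / 2 ∨ μe u v s t = 1) := by
  have hμ' := hμ
  obtain ⟨h1, h2, h3, h4, h5, h6, h7⟩ := hμ'
  simp only [Fintype.sum_bool] at h5 h6 h7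
  obtain ⟨hdv, hde⟩ := direction_eq_zero G hμ hvert
    (dv := fun u => unaryDirection (μv u true))
    (de := fun u v s t =>
      if G.Adj u v then pairDirection (μv u true) (μv v true) (μe u v true true) s t else 0)
    (by
      intro u s hs
      have h := h5 u
      have hz := @unaryShift_eq_zero_iff (μv u true)
      cases s <;> simp only [unaryDirection] <;> grind)
    (by
      intro u v huv s t hst
      have hl := h7 u v huv
      have hr := h6 u v huv
      have hlt := hl true
      have hlf := hl false
      have hrt := hr true
      have hu := h5 u
      simp only [huv, if_true]
      cases s <;> cases t <;> simp only [pairDirection]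
      · rw [show μe u v true true = μv u true + μv v true - 1 by linarith,
          pairShift_add_sub_one]
        ring
      · rw [show μe u v true true = μv v true by linarith, pairShift_comm, pairShift_left]
        ring
      · rw [show μe u v true true = μv u true by linarith, pairShift_left]
        ring
      · rw [hst, pairShift_zero])
    (by
      intro u v s t
      simp only [G.adj_comm v u, h3 v u true true]
      split_ifs
      · cases s <;> cases t <;>
          simp only [pairDirection, pairShift_comm (μv v true) (μv u true)]
        ring
      · rfl)
    (by
      intro u v huv s t
      simp [huv])
    (by simp [unaryDirection])
    (by
      intro u v huv t
      cases t
      · simp only [huv, if_true, Fintype.sum_bool, pairDirection, unaryDirection, Bool.false_eq_true,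
          if_false]
        ring
      · simp [huv, pairDirection, unaryDirection])
    (by
      intro u v huv s
      cases s <;> simp [huv, pairDirection, unaryDirection])
  have hshift : ∀ u, unaryShift (μv u true) = 0 := fun u => by
    simpa [unaryDirection] using congrFun (congrFun hdv u) true
  have hunary : ∀ u s, μv u s = 0 ∨ μv u s = 1 / 2 ∨ μv u s = 1 := by
    intro u s
    have h := unaryShift_eq_zero_iff.1 (hshift u)
    have hu := h5 u
    cases s <;> grind
  refine ⟨hunary, fun u v s t => ?_⟩
  by_cases huv : G.Adj u v
  swap
  · exact Or.inl (h4 u v huv s t)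
  have hpair : pairShift (μv u true) (μv v true) (μe u v true true) = 0 := by
    simpa [huv, pairDirection] using congrFun (congrFun (congrFun (congrFun hde u) v) true) true
  have hn := h2 u v huv
  have htt := hn true true
  have htf := hn true false
  have hft := hn false true
  have hff := hn false false
  have hlt := h7 u v huv true
  have hlf := h7 u v huv false
  have hrt := h6 u v huv true
  have hu := h5 u
  have hp := half_integral_of_pairShift_eq_zero htt (by linarith) (by linarith) (by linarith)
    (hshift u) (hshift v) hpair
  have hxu := hunary u true
  have hxv := hunary v true
  cases s <;> cases t <;> grind
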